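/- arXiv:2412.20915 — 4 statements merged into one kernel-verified Lean document; each statement's English description precedes it below -/
import Mathlib

section
/- Let W be an algebraic Weyl tensor on Euclidean ℝ⁴ in normal form with parameters λ₁,λ₂,λ₃,μ₁,μ₂,μ₃, and let T = c₁e₁ + c₂e₂ + c₃e₃ + c₄e₄ with c₁,c₂,c₃,c₄ ∈ ℝ. Then W(T,x,y,T) = 0 for all x,y ∈ ℝ⁴ if and only if the following ten equations hold: c₂²λ₁ + c₃²λ₂ + c₄²λ₃ = 0; c₁c₂λ₁ + c₃c₄(μ₂−μ₃) = 0; c₁c₃λ₂ + c₂c₄(μ₃−μ₁) = 0; c₁c₄λ₃ + c₂c₃(μ₁−μ₂) = 0; c₁²λ₁ + c₄²λ₂ + c₃²λ₃ = 0; c₂c₃λ₃ + c₁c₄(μ₁−μ₂) = 0; c₂c₄λ₂ + c₁c₃(μ₃−μ₁) = 0; c₄²λ₁ + c₁²λ₂ + c₂²λ₃ = 0; c₃c₄λ₁ + c₁c₂(μ₂−μ₃) = 0; c₃²λ₁ + c₂²λ₂ + c₁²λ₃ = 0. -/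
open scoped BigOperators

/-- Vectors in ℝ⁴. -/
abbrev V4 : Type := Fin 4 → ℝ

/-- Covariant 4-tensors (multilinear maps ℝ⁴×ℝ⁴×ℝ⁴×ℝ⁴ → ℝ). -/
abbrev Tensor4 : Type := MultilinearMap ℝ (fun _ : Fin 4 => V4) ℝ

/-- Evaluation of a 4-tensor on four vectors. -/
def tapp (W : Tensor4) (x y z w : V4) : ℝ := W ![x, y, z, w]

/-- Standard basis of ℝ⁴ (0-indexed: `e 0 = e₁`, …, `e 3 = e₄`). -/
def e (i : Fin 4) : V4 := Pi.single i 1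

/-- `W` is an algebraic Weyl tensor on Euclidean ℝ⁴: it has the symmetries of a
curvature tensor, satisfies the first Bianchi identity, and is trace-free with
respect to the Euclidean inner product. -/
def IsWeylE (W : Tensor4) : Prop :=
  (∀ x y z w, tapp W x y z w = - tapp W y x z w) ∧
  (∀ x y z w, tapp W x y z w = - tapp W x y w z) ∧
  (∀ x y z w, tapp W x y z w = tapp W z w x y) ∧
  (∀ x y z w, tapp W x y z w + tapp W y z x w + tapp W z x y w = 0) ∧
  (∀ x y, ∑ i : Fin 4, tapp W (e i) x y (e i) = 0)

/-- The six coordinate 2-planes `e₁∧e₂, e₁∧e₃, e₁∧e₄, e₃∧e₄, e₄∧e₂, e₂∧e₃`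
(0-indexed pairs). -/
def pairs : Fin 6 → Fin 4 × Fin 4 := ![(0,1), (0,2), (0,3), (2,3), (3,1), (1,2)]

/-- The normal-form matrix of the Weyl operator in the basis of coordinate 2-planes. -/
def NFmat (l1 l2 l3 m1 m2 m3 : ℝ) : Matrix (Fin 6) (Fin 6) ℝ :=
  !![l1, 0, 0, m1, 0, 0;
     0, l2, 0, 0, m2, 0;
     0, 0, l3, 0, 0, m3;
     m1, 0, 0, l1, 0, 0;
     0, m2, 0, 0, l2, 0;
     0, 0, m3, 0, 0, l3]

/-- `W` is in normal form with parameters `λ₁,λ₂,λ₃,μ₁,μ₂,μ₃`: the traces vanish,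
and the components `W(e_{pair c}, e_{pair r})` are exactly the entries of the
normal-form matrix.  (Together with the curvature symmetries this specifies all
components of `W`: those not obtained from the listed ones by symmetries are zero.) -/
def InNormalForm (W : Tensor4) (l1 l2 l3 m1 m2 m3 : ℝ) : Prop :=
  l1 + l2 + l3 = 0 ∧ m1 + m2 + m3 = 0 ∧
  ∀ c r : Fin 6,
    tapp W (e (pairs c).1) (e (pairs c).2) (e (pairs r).1) (e (pairs r).2) =
      NFmat l1 l2 l3 m1 m2 m3 r c

/-- The Plücker coordinates of `x ∧ y` with respect to the coordinate 2-planes `pairs`. -/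
def plucker (x y : V4) (c : Fin 6) : ℝ :=
  x (pairs c).1 * y (pairs c).2 - x (pairs c).2 * y (pairs c).1

/-- An alternating bilinear form on ℝ⁴ is determined by its values on coordinate 2-planes. -/
lemma bilin_eq_sum_plucker (B : V4 →ₗ[ℝ] V4 →ₗ[ℝ] ℝ) (hB : ∀ x y, B x y = -B y x) (x y : V4) :
    B x y = ∑ c, plucker x y c * B (e (pairs c).1) (e (pairs c).2) := by
  have expand (v : V4) : v = v 0 • e 0 + v 1 • e 1 + v 2 • e 2 + v 3 • e 3 := by
    ext i; fin_cases i <;> simp [e]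
  have diag (i : Fin 4) : B (e i) (e i) = 0 := by linarith [hB (e i) (e i)]
  conv_lhs => rw [expand x, expand y]
  simp [Fin.sum_univ_six, plucker, pairs, diag, hB (e 1) (e 0), hB (e 2) (e 0), hB (e 3) (e 0),
    hB (e 2) (e 1), hB (e 1) (e 3), hB (e 3) (e 2)]
  ring

lemma tapp_eq_update_zero (W : Tensor4) (x y z w : V4) :
    tapp W x y z w = W (Function.update ![0, y, z, w] 0 x) :=
  congrArg W (by ext i; fin_cases i <;> rfl)

lemma tapp_eq_update_one (W : Tensor4) (x y z w : V4) :
    tapp W x y z w = W (Function.update ![x, 0, z, w] 1 y) :=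
  congrArg W (by ext i; fin_cases i <;> rfl)

/-- A 4-tensor with the last two arguments fixed, as a bilinear form in the first two. -/
def bilinFst (W : Tensor4) (z w : V4) : V4 →ₗ[ℝ] V4 →ₗ[ℝ] ℝ :=
  LinearMap.mk₂ ℝ (fun x y => tapp W x y z w)
    (fun x x' y => by simp only [tapp_eq_update_zero, W.map_update_add])
    (fun a x y => by simp only [tapp_eq_update_zero, W.map_update_smul])
    (fun x y y' => by simp only [tapp_eq_update_one, W.map_update_add])
    (fun a x y => by simp only [tapp_eq_update_one, W.map_update_smul])

/-- A Weyl tensor in normal form, written in Plücker coordinates. -/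
lemma tapp_eq_sum_plucker {W : Tensor4} {l1 l2 l3 m1 m2 m3 : ℝ} (hW : IsWeylE W)
    (hNF : InNormalForm W l1 l2 l3 m1 m2 m3) (x y z w : V4) :
    tapp W x y z w =
      ∑ c, plucker x y c * ∑ r, plucker z w r * NFmat l1 l2 l3 m1 m2 m3 r c := by
  obtain ⟨anti, -, swap, -, -⟩ := hW
  have fst (x y z w : V4) : tapp W x y z w =
      ∑ c, plucker x y c * tapp W (e (pairs c).1) (e (pairs c).2) z w :=
    bilin_eq_sum_plucker (bilinFst W z w) (fun x y => anti x y z w) x y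
  rw [fst]
  refine Finset.sum_congr rfl fun c _ => ?_
  rw [swap, fst]
  congr 1
  refine Finset.sum_congr rfl fun r _ => ?_
  rw [swap, hNF.2.2]

/-- Theorem `thm:alg`: for a Weyl tensor in normal form,
`W(T,·,·,T) = 0` for `T = c₁e₁ + c₂e₂ + c₃e₃ + c₄e₄` iff the ten listed
equations hold. -/
theorem stmt0 (W : Tensor4) (l1 l2 l3 m1 m2 m3 c1 c2 c3 c4 : ℝ)
    (hW : IsWeylE W) (hNF : InNormalForm W l1 l2 l3 m1 m2 m3) :
    (∀ x y : V4,
        tapp W (c1 • e 0 + c2 • e 1 + c3 • e 2 + c4 • e 3) x y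
          (c1 • e 0 + c2 • e 1 + c3 • e 2 + c4 • e 3) = 0) ↔
      (c2^2*l1 + c3^2*l2 + c4^2*l3 = 0 ∧
       c1*c2*l1 + c3*c4*(m2 - m3) = 0 ∧
       c1*c3*l2 + c2*c4*(m3 - m1) = 0 ∧
       c1*c4*l3 + c2*c3*(m1 - m2) = 0 ∧
       c1^2*l1 + c4^2*l2 + c3^2*l3 = 0 ∧
       c2*c3*l3 + c1*c4*(m1 - m2) = 0 ∧
       c2*c4*l2 + c1*c3*(m3 - m1) = 0 ∧
       c4^2*l1 + c1^2*l2 + c2^2*l3 = 0 ∧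
       c3*c4*l1 + c1*c2*(m2 - m3) = 0 ∧
       c3^2*l1 + c2^2*l2 + c1^2*l3 = 0) := by
  simp only [tapp_eq_sum_plucker hW hNF, Fin.sum_univ_six, plucker, pairs, NFmat]
  constructor
  · intro h
    have h00 := h (e 0) (e 0)
    have h01 := h (e 0) (e 1)
    have h02 := h (e 0) (e 2)
    have h03 := h (e 0) (e 3)
    have h11 := h (e 1) (e 1)
    have h12 := h (e 1) (e 2)
    have h13 := h (e 1) (e 3)
    have h22 := h (e 2) (e 2)
    have h23 := h (e 2) (e 3)
    have h33 := h (e 3) (e 3)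
    simp [e] at h00 h01 h02 h03 h11 h12 h13 h22 h23 h33
    refine ⟨?_, ?_, ?_, ?_, ?_, ?_, ?_, ?_, ?_, ?_⟩
    · linear_combination -h00
    · linear_combination h01
    · linear_combination h02
    · linear_combination h03
    · linear_combination -h11
    · linear_combination h12
    · linear_combination h13
    · linear_combination -h22
    · linear_combination h23
    · linear_combination -h33
  · rintro ⟨h00, h01, h02, h03, h11, h12, h13, h22, h23, h33⟩ x y
    simp [e]
    linear_combination -(x 0 * y 0) * h00 + (x 0 * y 1 + x 1 * y 0) * h01
      + (x 0 * y 2 + x 2 * y 0) * h02 + (x 0 * y 3 + x 3 * y 0) * h03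
      - x 1 * y 1 * h11 + (x 1 * y 2 + x 2 * y 1) * h12 + (x 1 * y 3 + x 3 * y 1) * h13
      - x 2 * y 2 * h22 + (x 2 * y 3 + x 3 * y 2) * h23 - x 3 * y 3 * h33
end

section
/- Let W be an algebraic Weyl tensor on Euclidean ℝ⁴ in normal form with parameters λ₁,λ₂,λ₃,μ₁,μ₂,μ₃. If T = e₁ + e₂ + e₃ + e₄ satisfies W(T,x,y,T) = 0 for all x,y ∈ ℝ⁴, then each of the vectors −e₁−e₂+e₃+e₄, −e₁+e₂−e₃+e₄, and −e₁+e₂+e₃−e₄ also satisfies W(T',x,y,T') = 0 for all x,y ∈ ℝ⁴. -/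
open scoped BigOperators

/-- Two distinct indices form one of the six coordinate planes, up to order. -/
theorem eq_or_exists_pairs (i j : Fin 4) :
    i = j ∨ ∃ c, pairs c = (i, j) ∨ pairs c = (j, i) := by
  revert i j
  decide

theorem mul_e (s : V4) (i : Fin 4) : s * e i = s i • e i := by
  ext j
  by_cases h : j = i
  · subst h; simp [e]
  · simp [e, h]

theorem tapp_smul (W : Tensor4) (a b c d : ℝ) (x y z w : V4) :
    tapp W (a • x) (b • y) (c • z) (d • w) = a * b * c * d * tapp W x y z w := by
  have h := W.map_smul_univ ![a, b, c, d] ![x, y, z, w]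
  have hv : (fun i => ![a, b, c, d] i • ![x, y, z, w] i)
      = ![a • x, b • y, c • z, d • w] := by
    ext i : 1
    fin_cases i <;> rfl
  rw [hv] at h
  simpa [tapp, Fin.prod_univ_four] using h

/-- The normal-form matrix is invariant under sign changes of determinant one. -/
theorem sign_mul_NFmat (l1 l2 l3 m1 m2 m3 : ℝ) {s : V4} (hs : ∀ i, s i * s i = 1)
    (hdet : s 0 * s 1 * s 2 * s 3 = 1) (c r : Fin 6) :
    s (pairs c).1 * s (pairs c).2 * s (pairs r).1 * s (pairs r).2
        * NFmat l1 l2 l3 m1 m2 m3 r c = NFmat l1 l2 l3 m1 m2 m3 r c := by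
  have h0 := hs 0
  have h1 := hs 1
  have h2 := hs 2
  have h3 := hs 3
  fin_cases c <;> fin_cases r <;> simp [NFmat, pairs] <;> grind

/-- A Weyl tensor in normal form is invariant under diagonal sign changes of determinant one. -/
theorem InNormalForm.tapp_sign_mul {W : Tensor4} {l1 l2 l3 m1 m2 m3 : ℝ}
    (hNF : InNormalForm W l1 l2 l3 m1 m2 m3) (hW : IsWeylE W) {s : V4}
    (hs : ∀ i, s i * s i = 1) (hdet : s 0 * s 1 * s 2 * s 3 = 1) (x y z w : V4) :
    tapp W (s * x) (s * y) (s * z) (s * w) = tapp W x y z w := by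
  obtain ⟨h12, h34, -, -, -⟩ := hW
  have hbasis (i j k l : Fin 4) : s i * s j * s k * s l * tapp W (e i) (e j) (e k) (e l)
      = tapp W (e i) (e j) (e k) (e l) := by
    have hpairs (c r : Fin 6) := sign_mul_NFmat l1 l2 l3 m1 m2 m3 hs hdet c r
    simp only [← hNF.2.2] at hpairs
    rcases eq_or_exists_pairs i j with rfl | ⟨c, hc⟩
    · have := h12 (e i) (e i) (e k) (e l)
      rw [show tapp W (e i) (e i) (e k) (e l) = 0 by linarith, mul_zero]
    rcases eq_or_exists_pairs k l with rfl | ⟨r, hr⟩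
    · have := h34 (e i) (e j) (e k) (e k)
      rw [show tapp W (e i) (e j) (e k) (e k) = 0 by linarith, mul_zero]
    have h := hpairs c r
    have hij := h12 (e i) (e j) (e k) (e l)
    have hkl := h34 (e i) (e j) (e k) (e l)
    have hjikl := h34 (e j) (e i) (e k) (e l)
    rcases hc with hc | hc <;> rcases hr with hr | hr <;> simp only [hc, hr] at h <;> grind
  have hext : W.compLinearMap (fun _ => LinearMap.mulLeft ℝ s) = W := by
    refine Module.Basis.ext_multilinear (fun _ => Pi.basisFun ℝ (Fin 4)) fun v => ?_
    have h := hbasis (v 0) (v 1) (v 2) (v 3)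
    rw [← tapp_smul, ← mul_e, ← mul_e, ← mul_e, ← mul_e] at h
    convert h using 1
    · rw [MultilinearMap.compLinearMap_apply, tapp]
      congr 1
      ext i : 1
      fin_cases i <;> simp [e]
    · rw [tapp]
      congr 1
      ext i : 1
      fin_cases i <;> simp [e]
  have h := congrArg (fun W' : Tensor4 => tapp W' x y z w) hext
  rw [← h, tapp, tapp, MultilinearMap.compLinearMap_apply]
  congr 1
  ext i : 1
  fin_cases i <;> rfl

/-- Diagonal sign changes of determinant one preserve the solutions of `W(T,·,·,T) = 0`. -/
theorem InNormalForm.tapp_sign_mul_eq_zero {W : Tensor4} {l1 l2 l3 m1 m2 m3 : ℝ}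
    (hNF : InNormalForm W l1 l2 l3 m1 m2 m3) (hW : IsWeylE W) {s T : V4}
    (hs : ∀ i, s i * s i = 1) (hdet : s 0 * s 1 * s 2 * s 3 = 1)
    (hT : ∀ x y, tapp W T x y T = 0) (x y : V4) :
    tapp W (s * T) x y (s * T) = 0 := by
  have hss (z : V4) : s * (s * z) = z := by
    rw [← mul_assoc, show s * s = 1 from funext hs, one_mul]
  rw [← hss x, ← hss y, hNF.tapp_sign_mul hW hs hdet, hT]

/-- Corollary `cor:examples`, second part: if
`T = e₁+e₂+e₃+e₄` satisfies `W(T,·,·,T) = 0`, then so do the vectors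
`−e₁−e₂+e₃+e₄`, `−e₁+e₂−e₃+e₄`, and `−e₁+e₂+e₃−e₄`. -/
theorem stmt2 (W : Tensor4) (l1 l2 l3 m1 m2 m3 : ℝ)
    (hW : IsWeylE W) (hNF : InNormalForm W l1 l2 l3 m1 m2 m3)
    (hT : ∀ x y : V4,
        tapp W (e 0 + e 1 + e 2 + e 3) x y (e 0 + e 1 + e 2 + e 3) = 0) :
    (∀ x y : V4,
        tapp W (-e 0 - e 1 + e 2 + e 3) x y (-e 0 - e 1 + e 2 + e 3) = 0) ∧
    (∀ x y : V4,
        tapp W (-e 0 + e 1 - e 2 + e 3) x y (-e 0 + e 1 - e 2 + e 3) = 0) ∧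
    (∀ x y : V4,
        tapp W (-e 0 + e 1 + e 2 - e 3) x y (-e 0 + e 1 + e 2 - e 3) = 0) := by
  refine ⟨fun x y => ?_, fun x y => ?_, fun x y => ?_⟩
  · have hs : -e 0 - e 1 + e 2 + e 3 = ![-1, -1, 1, 1] * (e 0 + e 1 + e 2 + e 3) := by
      ext i
      fin_cases i <;> simp [e]
    rw [hs]
    exact hNF.tapp_sign_mul_eq_zero hW (by simp [Fin.forall_fin_succ]) (by simp) hT x y
  · have hs : -e 0 + e 1 - e 2 + e 3 = ![-1, 1, -1, 1] * (e 0 + e 1 + e 2 + e 3) := by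
      ext i
      fin_cases i <;> simp [e]
    rw [hs]
    exact hNF.tapp_sign_mul_eq_zero hW (by simp [Fin.forall_fin_succ]) (by simp) hT x y
  · have hs : -e 0 + e 1 + e 2 - e 3 = ![-1, 1, 1, -1] * (e 0 + e 1 + e 2 + e 3) := by
      ext i
      fin_cases i <;> simp [e]
    rw [hs]
    exact hNF.tapp_sign_mul_eq_zero hW (by simp [Fin.forall_fin_succ]) (by simp) hT x y
end

section
/- Let W be an algebraic Weyl tensor on Euclidean ℝ⁴ in normal form with parameters λ₁,λ₂,λ₃,μ₁,μ₂,μ₃. If μ₂ = μ₃ and λ₂ = λ₃ ≠ 0, then the only vector T ∈ ℝ⁴ satisfying W(T,x,y,T) = 0 for all x,y ∈ ℝ⁴ is T = 0. -/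
open scoped BigOperators

/-- The position in `pairs` of the coordinate 2-plane spanned by `e i` and `e j`
(arbitrary on the diagonal). -/
def pairIndex : Fin 4 → Fin 4 → Fin 6 :=
  ![![0, 0, 1, 2], ![0, 0, 5, 4], ![1, 5, 0, 3], ![2, 4, 3, 0]]

/-- The orientation of `e i ∧ e j` relative to the listed coordinate 2-plane,
zero on the diagonal. -/
def pairSign : Fin 4 → Fin 4 → ℝ :=
  ![![0, 1, 1, 1], ![-1, 0, 1, -1], ![-1, -1, 0, 1], ![-1, 1, -1, 0]]

theorem alternating_eq_pairSign_mul (f : V4 → V4 → ℝ) (hf : ∀ x y, f x y = -f y x)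
    (i j : Fin 4) :
    f (e i) (e j) =
      pairSign i j * f (e (pairs (pairIndex i j)).1) (e (pairs (pairIndex i j)).2) := by
  have hdiag : ∀ x, f x x = 0 := fun x => by linarith [hf x x]
  fin_cases i <;> fin_cases j <;> simp [pairSign, pairIndex, pairs, hdiag] <;> exact hf _ _

theorem InNormalForm.tapp_basis {W : Tensor4} {l1 l2 l3 m1 m2 m3 : ℝ}
    (hNF : InNormalForm W l1 l2 l3 m1 m2 m3) (hW : IsWeylE W) (i j k l : Fin 4) :
    tapp W (e i) (e j) (e k) (e l) =
      pairSign i j * (pairSign k l *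
        NFmat l1 l2 l3 m1 m2 m3 (pairIndex k l) (pairIndex i j)) := by
  rw [alternating_eq_pairSign_mul (fun x y => tapp W x y (e k) (e l))
      (fun x y => hW.1 x y _ _) i j,
    alternating_eq_pairSign_mul (tapp W _ _) (fun x y => hW.2.1 _ _ x y) k l, hNF.2.2]

theorem tapp_eq_sum_left (W : Tensor4) (T x y z : V4) :
    tapp W T x y z = ∑ i, T i * tapp W (e i) x y z := by
  have hT : T = ∑ i, T i • e i := by
    ext k
    simp [e, Finset.sum_apply, Pi.single_apply]
  have happ : ∀ v, tapp W v x y z = W.toLinearMap ![0, x, y, z] 0 v := fun v =>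
    congrArg W (Fin.update_cons_zero (α := fun _ => V4) 0 ![x, y, z] v).symm
  simp only [happ]
  conv_lhs => rw [hT]
  simp [map_sum]

theorem IsWeylE.tapp_reverse {W : Tensor4} (hW : IsWeylE W) (x y z w : V4) :
    tapp W x y z w = tapp W w z y x := by
  rw [hW.2.2.1, hW.1, hW.2.1, neg_neg]

theorem IsWeylE.tapp_eq_sum {W : Tensor4} (hW : IsWeylE W) (T x y : V4) :
    tapp W T x y T = ∑ i, T i * ∑ j, T j * tapp W (e i) x y (e j) := by
  rw [tapp_eq_sum_left]
  refine Finset.sum_congr rfl fun i _ => ?_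
  rw [hW.tapp_reverse, tapp_eq_sum_left]
  simp only [hW.tapp_reverse _ y x (e i)]

/-- Corollary `cor:examples`, last part: if `μ₂ = μ₃` and
`λ₂ = λ₃ ≠ 0`, then the only vector `T` with `W(T,·,·,T) = 0` is `T = 0`. -/
theorem stmt3 (W : Tensor4) (l1 l2 l3 m1 m2 m3 : ℝ)
    (hW : IsWeylE W) (hNF : InNormalForm W l1 l2 l3 m1 m2 m3)
    (hmu : m2 = m3) (hla : l2 = l3) (hl2 : l2 ≠ 0) :
    ∀ T : V4, (∀ x y : V4, tapp W T x y T = 0) → T = 0 := by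
  intro T hT
  have hcomp : ∀ a b : Fin 4, ∑ i, T i * ∑ j, T j *
      (pairSign i a * (pairSign b j *
        NFmat l1 l2 l3 m1 m2 m3 (pairIndex b j) (pairIndex i a))) = 0 := fun a b => by
    simpa only [hW.tapp_eq_sum, hNF.tapp_basis hW] using hT (e a) (e b)
  obtain ⟨hl, -, -⟩ := hNF
  have h0 := hcomp 0 0
  have h1 := hcomp 1 1
  have h2 := hcomp 2 2
  have h3 := hcomp 3 3
  have h01 := hcomp 0 1
  simp [Fin.sum_univ_four, pairSign, pairIndex, NFmat] at h0 h1 h2 h3 h01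
  subst hmu hla
  obtain rfl : l1 = -2 * l2 := by linarith
  have k0 : T 2 ^ 2 + T 3 ^ 2 = 2 * T 1 ^ 2 := mul_left_cancel₀ hl2 (by linarith)
  have k1 : T 2 ^ 2 + T 3 ^ 2 = 2 * T 0 ^ 2 := mul_left_cancel₀ hl2 (by linarith)
  have k2 : T 0 ^ 2 + T 1 ^ 2 = 2 * T 3 ^ 2 := mul_left_cancel₀ hl2 (by linarith)
  have k3 : T 0 ^ 2 + T 1 ^ 2 = 2 * T 2 ^ 2 := mul_left_cancel₀ hl2 (by linarith)
  have k01 : T 0 * T 1 = 0 := mul_left_cancel₀ hl2 (by linarith)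
  have hsq : T 0 ^ 2 = 0 := by
    rcases mul_eq_zero.mp k01 with h | h <;> simp only [h] at k0 k1 ⊢ <;> linarith
  ext i
  refine pow_eq_zero_iff two_ne_zero |>.mp ?_
  fin_cases i <;> simp only [Fin.zero_eta, Fin.mk_one, Fin.reduceFinMk] <;> linarith
end

section
/- Let M be a complex 3×3 matrix with Mᵀ = M which is diagonalizable over ℂ. Then there exists a basis z₁, z₂, z₃ of ℂ³ consisting of eigenvectors of M such that b(zⱼ, z_k) = δ_{jk} for all j,k ∈ {1,2,3}. -/
open Matrix

/-- Vectors in ℂ³. -/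
abbrev C3 : Type := Fin 3 → ℂ

/-- The symmetric bilinear form `b(z,w) = z₁w₁ + z₂w₂ + z₃w₃` on ℂ³. -/
def b (z w : C3) : ℂ := z 0 * w 0 + z 1 * w 1 + z 2 * w 2

/-- `M` is diagonalizable over ℂ: there is a basis of ℂ³ of eigenvectors of `M`. -/
def Diagonalizable3 (M : Matrix (Fin 3) (Fin 3) ℂ) : Prop :=
  ∃ (v : Fin 3 → C3) (μ : Fin 3 → ℂ),
    LinearIndependent ℂ v ∧ Submodule.span ℂ (Set.range v) = ⊤ ∧
    ∀ i, M.mulVec (v i) = μ i • v i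

section ComplexSymmetric

variable {K n : Type*} [Field K] [Fintype n] {M : Matrix n n K}

/-- Eigenvectors of a symmetric matrix for distinct eigenvalues are orthogonal for the
bilinear dot product. -/
lemma dotProduct_eq_zero_of_eigenvalue_ne (hM : M.IsSymm) {x y : n → K} {μ ν : K}
    (hx : M *ᵥ x = μ • x) (hy : M *ᵥ y = ν • y) (h : μ ≠ ν) : x ⬝ᵥ y = 0 := by
  have key : x ⬝ᵥ (M *ᵥ y) = (M *ᵥ x) ⬝ᵥ y := by
    rw [dotProduct_mulVec, ← mulVec_transpose, hM.eq]
  rw [hx, hy, dotProduct_smul, smul_dotProduct, smul_eq_mul, smul_eq_mul] at key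
  exact (mul_eq_mul_right_iff.mp key).resolve_left h.symm

/-- Subtracting from an eigenvector its dot product components along a family of eigenvectors
yields a vector in the same eigenspace. -/
lemma mulVec_sub_sum_dotProduct_smul (hM : M.IsSymm) {ι : Type*} [Fintype ι]
    {z : ι → n → K} {ν : ι → K} (hz : ∀ i, M *ᵥ z i = ν i • z i) {v : n → K} {μ : K}
    (hv : M *ᵥ v = μ • v) :
    M *ᵥ (v - ∑ j, (z j ⬝ᵥ v) • z j) = μ • (v - ∑ j, (z j ⬝ᵥ v) • z j) := by
  rw [mulVec_sub, hv, smul_sub, mulVec_sum, Finset.smul_sum]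
  congr 1
  refine Finset.sum_congr rfl fun j _ ↦ ?_
  rw [mulVec_smul, hz]
  by_cases h : ν j = μ
  · rw [h, smul_comm]
  · simp [dotProduct_eq_zero_of_eigenvalue_ne hM (hz j) hv h]

/-- If the eigenvectors of a symmetric matrix span the space, an orthonormal family of too few
eigenvectors has a non-isotropic eigenvector in its orthogonal complement. -/
lemma exists_eigenvector_dotProduct_self_ne_zero (h2 : (2 : K) ≠ 0) (hM : M.IsSymm)
    (hspan : Submodule.span K {v : n → K | ∃ μ : K, M *ᵥ v = μ • v} = ⊤)
    {ι : Type*} [Fintype ι] [DecidableEq ι] {z : ι → n → K} {ν : ι → K}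
    (hz : ∀ i, M *ᵥ z i = ν i • z i)
    (horth : ∀ i j, z i ⬝ᵥ z j = if i = j then 1 else 0)
    (hcard : Fintype.card ι < Fintype.card n) :
    ∃ (x : n → K) (μ : K), M *ᵥ x = μ • x ∧ (∀ j, z j ⬝ᵥ x = 0) ∧ x ⬝ᵥ x ≠ 0 := by
  by_contra! hiso
  have isotropic {x y : n → K} {μ μ' : K} (hx : M *ᵥ x = μ • x) (hy : M *ᵥ y = μ' • y)
      (hzx : ∀ j, z j ⬝ᵥ x = 0) (hzy : ∀ j, z j ⬝ᵥ y = 0) : x ⬝ᵥ y = 0 := by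
    by_cases h : μ = μ'
    · subst h
      have hadd := hiso (x + y) μ (by rw [mulVec_add, hx, hy, smul_add])
        fun j ↦ by rw [dotProduct_add, hzx, hzy, add_zero]
      rw [add_dotProduct, dotProduct_add, dotProduct_add, hiso x μ hx hzx, hiso y μ hy hzy,
        dotProduct_comm y x, zero_add, add_zero, ← two_mul] at hadd
      exact (mul_eq_zero.mp hadd).resolve_left h2
    · exact dotProduct_eq_zero_of_eigenvalue_ne hM hx hy h
  have orth_proj (v : n → K) (i : ι) : z i ⬝ᵥ (v - ∑ j, (z j ⬝ᵥ v) • z j) = 0 := by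
    simp [dotProduct_sub, dotProduct_sum, horth]
  have mem_span : {v : n → K | ∃ μ : K, M *ᵥ v = μ • v} ⊆ Submodule.span K (Set.range z) := by
    rintro v ⟨μ, hv⟩
    have hzero : v - ∑ j, (z j ⬝ᵥ v) • z j = 0 := by
      refine dotProduct_eq_zero _ fun u ↦ ?_
      have hu : u ∈ Submodule.span K {v : n → K | ∃ μ : K, M *ᵥ v = μ • v} :=
        hspan ▸ Submodule.mem_top
      induction hu using Submodule.span_induction with
      | mem u hu =>
        obtain ⟨μ', hu⟩ := hu
        have h := isotropic (mulVec_sub_sum_dotProduct_smul hM hz hv)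
          (mulVec_sub_sum_dotProduct_smul hM hz hu) (orth_proj v) (orth_proj u)
        rw [dotProduct_sub, dotProduct_sum] at h
        simpa only [dotProduct_smul, dotProduct_comm _ (z _), orth_proj, smul_zero,
          Finset.sum_const_zero, sub_zero] using h
      | zero => exact dotProduct_zero _
      | add x y _ _ hx hy => rw [dotProduct_add, hx, hy, add_zero]
      | smul a x _ hx => rw [dotProduct_smul, hx, smul_zero]
    rw [sub_eq_zero.mp hzero]
    exact Submodule.sum_mem _ fun j _ ↦
      Submodule.smul_mem _ _ (Submodule.subset_span (Set.mem_range_self j))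
  have htop : Submodule.span K (Set.range z) = ⊤ :=
    top_le_iff.mp (hspan ▸ Submodule.span_le.mpr mem_span)
  have hle := finrank_range_le_card (R := K) z
  rw [Set.finrank, htop, finrank_top, Module.finrank_fintype_fun_eq_card] at hle
  exact hle.not_gt hcard

/-- A symmetric matrix over an algebraically closed field of characteristic not two whose
eigenvectors span the space has orthonormal families of eigenvectors of every size up to
the dimension. -/
lemma exists_orthonormal_eigenvectors [IsAlgClosed K] (h2 : (2 : K) ≠ 0) (hM : M.IsSymm)
    (hspan : Submodule.span K {v : n → K | ∃ μ : K, M *ᵥ v = μ • v} = ⊤)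
    (k : ℕ) (hk : k ≤ Fintype.card n) :
    ∃ (z : Fin k → n → K) (μ : Fin k → K), (∀ i, M *ᵥ z i = μ i • z i) ∧
      ∀ i j, z i ⬝ᵥ z j = if i = j then 1 else 0 := by
  induction k with
  | zero => exact ⟨Fin.elim0, Fin.elim0, fun i ↦ i.elim0, fun i ↦ i.elim0⟩
  | succ k ih =>
    obtain ⟨z, ν, hz, horth⟩ := ih (by omega)
    obtain ⟨x, μ, hx, hzx, hne⟩ := exists_eigenvector_dotProduct_self_ne_zero h2 hM hspan hz
      horth (by simpa using hk)
    obtain ⟨c, hc⟩ := IsAlgClosed.exists_pow_nat_eq (x ⬝ᵥ x) two_pos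
    have hc0 : c ≠ 0 := by
      rintro rfl
      exact hne (by simp [← hc])
    refine ⟨Fin.snoc z (c⁻¹ • x), Fin.snoc ν μ, ?_, ?_⟩
    · intro i
      refine Fin.lastCases ?_ (fun i ↦ ?_) i
      · simp only [Fin.snoc_last]
        rw [mulVec_smul, hx, smul_comm]
      · simpa only [Fin.snoc_castSucc] using hz i
    · intro i j
      refine Fin.lastCases ?_ (fun i ↦ ?_) i <;> refine Fin.lastCases ?_ (fun j ↦ ?_) j
      · simp only [Fin.snoc_last, smul_dotProduct, dotProduct_smul, ← hc, smul_eq_mul, if_true]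
        field_simp
      · simp [dotProduct_comm x, hzx, (Fin.castSucc_lt_last j).ne']
      · simp [hzx, (Fin.castSucc_lt_last i).ne]
      · simp [horth]

/-- A family which is orthonormal for the bilinear dot product is linearly independent. -/
lemma linearIndependent_of_dotProduct_eq_ite {ι : Type*} [Fintype ι] [DecidableEq ι]
    {z : ι → n → K} (horth : ∀ i j, z i ⬝ᵥ z j = if i = j then 1 else 0) :
    LinearIndependent K z := by
  rw [Fintype.linearIndependent_iff]
  intro g hg i
  simpa [dotProduct_sum, horth] using congrArg (z i ⬝ᵥ ·) hg

end ComplexSymmetric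

lemma b_eq_dotProduct (z w : C3) : b z w = z ⬝ᵥ w := by
  simp [b, dotProduct, Fin.sum_univ_three]

/-- Type I/D case of Proposition `thm:JordanPcoo`: a complex
symmetric diagonalizable 3×3 matrix has a basis of eigenvectors `z₁, z₂, z₃`
with `b(zⱼ, z_k) = δ_{jk}`. -/
theorem stmt15 (M : Matrix (Fin 3) (Fin 3) ℂ) (hM : Mᵀ = M)
    (hdiag : Diagonalizable3 M) :
    ∃ (z : Fin 3 → C3) (μ : Fin 3 → ℂ),
      LinearIndependent ℂ z ∧ Submodule.span ℂ (Set.range z) = ⊤ ∧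
      (∀ i, M.mulVec (z i) = μ i • z i) ∧
      (∀ j k, b (z j) (z k) = if j = k then 1 else 0) := by
  obtain ⟨v, ν, -, hv, heig⟩ := hdiag
  have hspan : Submodule.span ℂ {v : C3 | ∃ μ : ℂ, M *ᵥ v = μ • v} = ⊤ := by
    refine top_le_iff.mp (hv ▸ Submodule.span_mono ?_)
    rintro _ ⟨i, rfl⟩
    exact ⟨ν i, heig i⟩
  obtain ⟨z, μ, hz, horth⟩ := exists_orthonormal_eigenvectors two_ne_zero hM hspan 3 (by simp)
  have hli := linearIndependent_of_dotProduct_eq_ite horth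
  exact ⟨z, μ, hli, hli.span_eq_top_of_card_eq_finrank (by simp), hz,
    fun j k ↦ (b_eq_dotProduct _ _).trans (horth j k)⟩
end
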